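/- Fix λ₁ ≥ 0 and δ > 0. Let q¹,…,q^N be i.i.d. Uniform(0,1) and set ℓ(𝐪) = Σ_{n=1}^N log(1 + (λ₁ log N / N) f₁(q^n) + (λ₂/√(N log N)) f₂(q^n)). Then sup_{δ ≤ λ₂ ≤ √N} P(ℓ(𝐪) ≤ −C λ₂²) → 0 as C → ∞ and N → ∞; that is, for every η > 0 there exist C₀ and N₀ such that for all C ≥ C₀ and N ≥ N₀, sup_{δ ≤ λ₂ ≤ √N} P(ℓ(𝐪) ≤ −C λ₂²) ≤ η. -/

import Mathlib

open MeasureTheory ProbabilityTheory Real Filter Set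
open scoped ENNReal NNReal

noncomputable section

def f1 (p : ℝ) : ℝ := 1 / (p * (2 - Real.log p) ^ 2) - 1 / 2

def f2 (p : ℝ) : ℝ := 1 / Real.sqrt p - 2

/-- The sparsity likelihood score
`ℓ(p) = log(1 + (λ₁ log N / N) f₁(p) + (λ₂/√(N log N)) f₂(p))` of a single p-value. -/
def slTerm (N : ℕ) (lam1 lam2 p : ℝ) : ℝ :=
  Real.log (1 + lam1 * Real.log N / N * f1 p +
    lam2 / Real.sqrt (N * Real.log N) * f2 p)

/-- The law of `N` i.i.d. Uniform(0,1) random variables. -/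
def uniformCube (N : ℕ) : Measure (Fin N → ℝ) :=
  Measure.pi fun _ => volume.restrict (Ioo (0 : ℝ) 1)

/-- Exponential of minus the score of one p-value. -/
def phi (a b p : ℝ) : ℝ := Real.exp (-Real.log (1 + a * f1 p + b * f2 p))

lemma f1_ge {p : ℝ} (hp : 0 ≤ p) : -(1/2) ≤ f1 p := by
  unfold f1
  have : 0 ≤ 1 / (p * (2 - Real.log p) ^ 2) := by positivity
  linarith

lemma f2_ge {p : ℝ} : -2 ≤ f2 p := by
  unfold f2
  have : 0 ≤ 1 / Real.sqrt p := by positivity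
  linarith

lemma arg_ge {a b p : ℝ} (ha : 0 ≤ a) (hb : 0 ≤ b) (hab : a / 2 + 2 * b ≤ 1 / 2) (hp : 0 ≤ p) :
    1 / 2 ≤ 1 + (a * f1 p + b * f2 p) := by
  have h1 := mul_le_mul_of_nonneg_left (f1_ge hp) ha
  have h2 := mul_le_mul_of_nonneg_left (f2_ge (p := p)) hb
  linarith

lemma phi_eq {a b p : ℝ} (ha : 0 ≤ a) (hb : 0 ≤ b) (hab : a / 2 + 2 * b ≤ 1 / 2) (hp : 0 ≤ p) :
    phi a b p = (1 + (a * f1 p + b * f2 p))⁻¹ := by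
  have h := arg_ge ha hb hab hp
  unfold phi
  rw [Real.exp_neg, ← add_assoc, Real.exp_log (by linarith)]

lemma phi_pos (a b p : ℝ) : 0 < phi a b p := Real.exp_pos _

lemma phi_le_two {a b p : ℝ} (ha : 0 ≤ a) (hb : 0 ≤ b) (hab : a / 2 + 2 * b ≤ 1 / 2)
    (hp : 0 ≤ p) : phi a b p ≤ 2 := by
  have h := arg_ge ha hb hab hp
  rw [phi_eq ha hb hab hp]
  have := inv_anti₀ (by norm_num) h
  norm_num at this ⊢
  exact this

lemma phi_meas (a b : ℝ) : Measurable (phi a b) := by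
  unfold phi f1 f2
  fun_prop

lemma phi_int {a b : ℝ} (ha : 0 ≤ a) (hb : 0 ≤ b) (hab : a / 2 + 2 * b ≤ 1 / 2) :
    IntegrableOn (phi a b) (Icc 0 1) := by
  refine Measure.integrableOn_of_bounded (M := 2) (by simp) (phi_meas a b).aestronglyMeasurable ?_
  filter_upwards [ae_restrict_mem measurableSet_Icc] with p hp
  rw [Real.norm_of_nonneg (phi_pos _ _ _).le]
  exact phi_le_two ha hb hab hp.1

/-- Comparison derivative. -/
def psi (a b p : ℝ) : ℝ :=
  1 - a * (1 / (p * (2 - Real.log p) ^ 2) - 1 / 2) - b * (1 / Real.sqrt p - 2)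
    + 4 * a ^ 2 * (2 * (2 - Real.log p) / (p ^ 2 * (4 - Real.log p) ^ 3) + 1 / 4)
    + 4 * b ^ 2 * (1 / p + 4)

/-- Comparison antiderivative. -/
def Psi (a b p : ℝ) : ℝ :=
  p - a * ((2 - Real.log p)⁻¹ - p / 2) - b * (2 * Real.sqrt p - 2 * p)
    + 4 * a ^ 2 * (-2 * (p * (4 - Real.log p) ^ 2)⁻¹ + p / 4)
    + 4 * b ^ 2 * (Real.log p + 4 * p)

lemma Psi_deriv (a b : ℝ) {p : ℝ} (hp : 0 < p) (hp1 : p ≤ 1) :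
    HasDerivAt (Psi a b) (psi a b p) p := by
  have hl : Real.log p ≤ 0 := Real.log_nonpos hp.le hp1
  have hs : 0 < Real.sqrt p := Real.sqrt_pos.2 hp
  have dl := Real.hasDerivAt_log hp.ne'
  have ds := Real.hasDerivAt_sqrt hp.ne'
  have di := hasDerivAt_id p
  have h2 : (2 - Real.log p) ≠ 0 := by linarith
  have h4 : (4 - Real.log p) ≠ 0 := by linarith
  have d1 := (dl.const_sub 2).inv h2
  have d2 := (di.mul ((dl.const_sub 4).pow 2)).inv
    (by simp only [Pi.mul_apply, Pi.pow_apply, id]; positivity)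
  have D := ((((di.sub ((d1.sub (di.div_const 2)).const_mul a)).sub
    (((ds.const_mul 2).sub (di.const_mul 2)).const_mul b)).add
    (((d2.const_mul (-2)).add (di.div_const 4)).const_mul (4 * a ^ 2))).add
    ((dl.add (di.const_mul 4)).const_mul (4 * b ^ 2)))
  refine D.congr_deriv ?_
  simp only [Pi.mul_apply, Pi.pow_apply, id, psi]
  generalize Real.log p = L at *
  generalize Real.sqrt p = s at *
  have e1 : (-(-p⁻¹) / (2 - L) ^ 2) = 1 / (p * (2 - L) ^ 2) := by field_simp
  have e2 : 2 * (1 / (2 * s)) = 1 / s := by field_simp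
  have e3 : -2 * (-(1 * (4 - L) ^ 2 + p * (((2 : ℕ) : ℝ) * (4 - L) ^ (2 - 1) * -p⁻¹)) /
      (p * (4 - L) ^ 2) ^ 2) = 2 * (2 - L) / (p ^ 2 * (4 - L) ^ 3) := by
    push_cast
    field_simp
    ring
  rw [e1, e2, e3]
  ring

lemma phi_le_psi {a b p : ℝ} (ha : 0 ≤ a) (hb : 0 ≤ b) (hab : a / 2 + 2 * b ≤ 1 / 2)
    (hp : 0 < p) (hp1 : p ≤ 1) : phi a b p ≤ psi a b p := by
  have hl : Real.log p ≤ 0 := Real.log_nonpos hp.le hp1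
  have h := arg_ge ha hb hab hp.le
  rw [phi_eq ha hb hab hp.le]
  have key : (1 + (a * f1 p + b * f2 p))⁻¹ ≤
      1 - (a * f1 p + b * f2 p) + 2 * (a * f1 p + b * f2 p) ^ 2 := by
    generalize a * f1 p + b * f2 p = x at *
    rw [inv_le_iff_one_le_mul₀ (by linarith)]
    nlinarith [mul_nonneg (sq_nonneg x) (by linarith : (0:ℝ) ≤ 1 + 2 * x)]
  have k2 : (a * f1 p + b * f2 p) ^ 2 ≤ 2 * a ^ 2 * (f1 p) ^ 2 + 2 * b ^ 2 * (f2 p) ^ 2 := by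
    nlinarith [sq_nonneg (a * f1 p - b * f2 p)]
  have k3 : (f1 p) ^ 2 ≤ 2 * (2 - Real.log p) / (p ^ 2 * (4 - Real.log p) ^ 3) + 1 / 4 := by
    have h0 : 0 ≤ 1 / (p * (2 - Real.log p) ^ 2) := by positivity
    have : (1 / (p * (2 - Real.log p) ^ 2)) ^ 2 ≤
        2 * (2 - Real.log p) / (p ^ 2 * (4 - Real.log p) ^ 3) := by
      obtain ⟨u, hu⟩ : ∃ u, u = 2 - Real.log p := ⟨_, rfl⟩
      have hu2 : 2 ≤ u := by linarith
      have e : 4 - Real.log p = u + 2 := by linarith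
      rw [e, ← hu, div_pow, div_le_div_iff₀ (by positivity) (by positivity)]
      have q1 : (u + 2) ^ 3 ≤ (2 * u) ^ 3 := by
        apply pow_le_pow_left₀ <;> linarith
      have q2 : 0 ≤ u ^ 3 * (u ^ 2 - 4) := mul_nonneg (by positivity) (by nlinarith)
      have q3 : (u + 2) ^ 3 ≤ 2 * u ^ 5 := by nlinarith
      have := mul_le_mul_of_nonneg_left q3 (sq_nonneg p)
      nlinarith
    unfold f1
    nlinarith
  have k4 : (f2 p) ^ 2 ≤ 1 / p + 4 := by
    have h0 : 0 ≤ 1 / Real.sqrt p := by positivity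
    have : (1 / Real.sqrt p) ^ 2 = 1 / p := by rw [div_pow, Real.sq_sqrt hp.le, one_pow]
    unfold f2
    nlinarith
  have k5 := mul_le_mul_of_nonneg_left k3 (sq_nonneg a)
  have k6 := mul_le_mul_of_nonneg_left k4 (sq_nonneg b)
  have : psi a b p = 1 - (a * f1 p + b * f2 p)
    + 4 * a ^ 2 * (2 * (2 - Real.log p) / (p ^ 2 * (4 - Real.log p) ^ 3) + 1 / 4)
    + 4 * b ^ 2 * (1 / p + 4) := by
    unfold psi f1 f2; ring
  rw [this]
  linarith

lemma phi_integral {a b : ℝ} (ha : 0 ≤ a) (hb : 0 ≤ b) (hab : a / 2 + 2 * b ≤ 1 / 2)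
    {n : ℝ} (hn : 1 ≤ n) :
    ∫ p in Ioo (0:ℝ) 1, phi a b p ≤ 1 + (2 / n + a / (2 + Real.log n) + 2 * b / Real.sqrt n
      + 4 * a ^ 2 * (1 / 4 + 2 * n / (4 + Real.log n) ^ 2) + 4 * b ^ 2 * (4 + Real.log n)) := by
  have hn0 : 0 < n := by linarith
  have ht0 : 0 < n⁻¹ := by positivity
  have ht1 : n⁻¹ ≤ 1 := inv_le_one_of_one_le₀ hn
  have hI := phi_int ha hb hab
  rw [← integral_Ioc_eq_integral_Ioo, ← intervalIntegral.integral_of_le zero_le_one]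
  have i1 : IntervalIntegrable (phi a b) volume 0 n⁻¹ := by
    rw [intervalIntegrable_iff_integrableOn_Icc_of_le ht0.le]
    exact hI.mono_set (Icc_subset_Icc_right ht1)
  have i2 : IntervalIntegrable (phi a b) volume n⁻¹ 1 := by
    rw [intervalIntegrable_iff_integrableOn_Icc_of_le ht1]
    exact hI.mono_set (Icc_subset_Icc_left ht0.le)
  rw [← intervalIntegral.integral_add_adjacent_intervals i1 i2]
  have b1 : ∫ p in (0:ℝ)..n⁻¹, phi a b p ≤ 2 * n⁻¹ := by
    have := intervalIntegral.norm_integral_le_of_norm_le_const (a := 0) (b := n⁻¹) (C := 2)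
      (f := phi a b) (by
        intro x hx
        rw [uIoc_of_le ht0.le] at hx
        rw [Real.norm_of_nonneg (phi_pos _ _ _).le]
        exact phi_le_two ha hb hab hx.1.le)
    rw [sub_zero, abs_of_pos ht0] at this
    exact (le_abs_self _).trans this
  have b2 : ∫ p in n⁻¹..1, phi a b p ≤ Psi a b 1 - Psi a b n⁻¹ := by
    apply intervalIntegral.integral_le_sub_of_hasDeriv_right_of_le (g' := psi a b) ht1
    · intro x hx
      exact (Psi_deriv a b (ht0.trans_le hx.1) hx.2).continuousAt.continuousWithinAt
    · intro x hx
      exact (Psi_deriv a b (ht0.trans hx.1) hx.2.le).hasDerivWithinAt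
    · exact hI.mono_set (Icc_subset_Icc_left ht0.le)
    · intro x hx
      exact phi_le_psi ha hb hab (ht0.trans hx.1) hx.2.le
  have e1 : Psi a b 1 = 1 + 4 * a ^ 2 * (1 / 8) + 4 * b ^ 2 * 4 := by
    unfold Psi; rw [Real.log_one, Real.sqrt_one]; norm_num
  have e2 : Psi a b n⁻¹ = n⁻¹ - a / (2 + Real.log n) + a * n⁻¹ / 2 - 2 * b / Real.sqrt n
      + 2 * b * n⁻¹ - 4 * a ^ 2 * (2 * n / (4 + Real.log n) ^ 2) + a ^ 2 * n⁻¹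
      - 4 * b ^ 2 * Real.log n + 16 * b ^ 2 * n⁻¹ := by
    unfold Psi
    rw [Real.log_inv, Real.sqrt_inv, mul_inv, inv_inv]
    simp only [sub_neg_eq_add, div_eq_mul_inv]
    ring
  have p1 : 0 ≤ a * n⁻¹ := by positivity
  have p2 : 0 ≤ b * n⁻¹ := by positivity
  have p3 : 0 ≤ a ^ 2 * n⁻¹ := by positivity
  have p4 : 0 ≤ b ^ 2 * n⁻¹ := by positivity
  have p5 : 0 ≤ a ^ 2 := by positivity
  have e3 : 2 / n = 2 * n⁻¹ := div_eq_mul_inv _ _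
  rw [e1, e2] at b2
  linarith

/-- Exponential Markov inequality. -/
lemma markov_bound {N : ℕ} {lam1 lam2 a b c r : ℝ} (hN : 0 < N)
    (hae : a = lam1 * Real.log N / N) (hbe : b = lam2 / Real.sqrt (N * Real.log N))
    (ha : 0 ≤ a) (hb : 0 ≤ b) (hab : a / 2 + 2 * b ≤ 1 / 2)
    (hr : ∫ p in Ioo (0:ℝ) 1, phi a b p ≤ 1 + r / N) :
    uniformCube N {q | ∑ n : Fin N, slTerm N lam1 lam2 (q n) ≤ -c} ≤
      ENNReal.ofReal (Real.exp (r - c)) := by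
  have hN' : (0:ℝ) < N := by exact_mod_cast hN
  set I := ∫ p in Ioo (0:ℝ) 1, phi a b p with hIdef
  have hI0 : 0 ≤ I := integral_nonneg fun p => (phi_pos _ _ _).le
  have hInt : Integrable (phi a b) (volume.restrict (Ioo (0:ℝ) 1)) :=
    (phi_int ha hb hab).mono_set Ioo_subset_Icc_self
  have hprod : ∀ q : Fin N → ℝ, ∏ n, phi a b (q n) =
      Real.exp (-∑ n : Fin N, slTerm N lam1 lam2 (q n)) := by
    intro q
    rw [← Finset.sum_neg_distrib, Real.exp_sum]
    simp only [phi, slTerm, hae, hbe]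
  have hset : {q : Fin N → ℝ | ∑ n : Fin N, slTerm N lam1 lam2 (q n) ≤ -c} =
      {q | Real.exp c ≤ ∏ n, phi a b (q n)} := by
    ext q
    simp only [mem_ofPred_eq, hprod, Real.exp_le_exp]
    constructor <;> intro h <;> linarith
  have hfin : IsFiniteMeasure (uniformCube N) := by unfold uniformCube; infer_instance
  have hm := mul_meas_ge_le_integral_of_nonneg (μ := uniformCube N)
    (f := fun q => ∏ n, phi a b (q n))
    (Eventually.of_forall fun q => Finset.prod_nonneg fun n _ => (phi_pos _ _ _).le)
    (by unfold uniformCube; exact Integrable.fintype_prod fun _ => hInt) (Real.exp c)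
  have hpow : ∫ q, ∏ n, phi a b (q n) ∂(uniformCube N) = I ^ N := by
    unfold uniformCube
    rw [integral_fintype_prod_eq_pow]
    simp [hIdef]
  have hIr : I ^ N ≤ Real.exp r := by
    calc I ^ N ≤ (Real.exp (r / N)) ^ N := by
          apply pow_le_pow_left₀ hI0
          linarith [Real.add_one_le_exp (r / N)]
      _ = Real.exp r := by
          rw [← Real.exp_nat_mul]; congr 1; field_simp
  rw [hset, ← ofReal_measureReal]
  apply ENNReal.ofReal_le_ofReal
  rw [Real.exp_sub, le_div_iff₀ (Real.exp_pos _), mul_comm]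
  rw [hpow] at hm
  exact hm.trans hIr

lemma numeric_bound {lam1 lam2 n L δ : ℝ} (h1 : 0 ≤ lam1) (hδ : 0 < δ) (h2 : δ ≤ lam2)
    (hn : 1 ≤ n) (hL : 1 ≤ L) (hLn : L ^ 2 ≤ n) :
    2 / n + (lam1 * L / n) / (2 + L) + 2 * (lam2 / Real.sqrt (n * L)) / Real.sqrt n
      + 4 * (lam1 * L / n) ^ 2 * (1 / 4 + 2 * n / (4 + L) ^ 2)
      + 4 * (lam2 / Real.sqrt (n * L)) ^ 2 * (4 + L) ≤
    (((2 + lam1 + 9 * lam1 ^ 2) / δ ^ 2 + 2 / δ + 20) * lam2 ^ 2) / n := by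
  have hn0 : 0 < n := by linarith
  have hL0 : 0 < L := by linarith
  have hl0 : 0 < lam2 := by linarith
  have t1 : (lam1 * L / n) / (2 + L) ≤ lam1 / n := by
    rw [div_div, div_le_div_iff₀ (by positivity) hn0]
    nlinarith [mul_nonneg h1 hn0.le]
  have t2 : 2 * (lam2 / Real.sqrt (n * L)) / Real.sqrt n ≤ 2 * lam2 / n := by
    have hs : 1 ≤ Real.sqrt L := by rw [Real.one_le_sqrt]; exact hL
    have : 2 * (lam2 / Real.sqrt (n * L)) / Real.sqrt n = 2 * lam2 / (n * Real.sqrt L) := by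
      rw [Real.sqrt_mul hn0.le, ← mul_div_assoc, div_div]
      congr 1
      nlinarith [Real.mul_self_sqrt hn0.le]
    rw [this]
    apply div_le_div_of_nonneg_left (by positivity) hn0
    nlinarith
  have t3 : 4 * (lam1 * L / n) ^ 2 * (1 / 4 + 2 * n / (4 + L) ^ 2) ≤ 9 * lam1 ^ 2 / n := by
    have u1 : (lam1 * L / n) ^ 2 ≤ lam1 ^ 2 / n := by
      rw [div_pow, div_le_div_iff₀ (by positivity) hn0]
      have := mul_le_mul_of_nonneg_left hLn (by positivity : 0 ≤ lam1 ^ 2 * n)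
      nlinarith
    have u2 : (lam1 * L / n) ^ 2 * (2 * n / (4 + L) ^ 2) ≤ 2 * lam1 ^ 2 / n := by
      have : (lam1 * L / n) ^ 2 * (2 * n / (4 + L) ^ 2) =
          (2 * lam1 ^ 2 / n) * (L ^ 2 / (4 + L) ^ 2) := by field_simp
      rw [this]
      apply mul_le_of_le_one_right (by positivity)
      rw [div_le_one (by positivity)]
      nlinarith
    have : 9 * lam1 ^ 2 / n = lam1 ^ 2 / n + 4 * (2 * lam1 ^ 2 / n) := by ring
    rw [this]
    linarith
  have t4 : 4 * (lam2 / Real.sqrt (n * L)) ^ 2 * (4 + L) ≤ 20 * lam2 ^ 2 / n := by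
    rw [div_pow, Real.sq_sqrt (by positivity), ← mul_div_assoc, div_mul_eq_mul_div,
      div_le_div_iff₀ (by positivity) hn0]
    nlinarith [mul_nonneg (mul_nonneg (sq_nonneg lam2) hn0.le) (by linarith : 0 ≤ L - 1)]
  have s1 : 1 ≤ lam2 ^ 2 / δ ^ 2 := by
    rw [one_le_div (by positivity)]
    exact pow_le_pow_left₀ hδ.le h2 2
  have s2 : lam2 ≤ lam2 ^ 2 / δ := by
    rw [le_div_iff₀ hδ]; nlinarith
  have s3 := mul_le_mul_of_nonneg_left s1 (by positivity : 0 ≤ 2 + lam1 + 9 * lam1 ^ 2)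
  have tot : 2 + lam1 + 2 * lam2 + 9 * lam1 ^ 2 + 20 * lam2 ^ 2 ≤
      ((2 + lam1 + 9 * lam1 ^ 2) / δ ^ 2 + 2 / δ + 20) * lam2 ^ 2 := by
    have : ((2 + lam1 + 9 * lam1 ^ 2) / δ ^ 2 + 2 / δ + 20) * lam2 ^ 2 =
      (2 + lam1 + 9 * lam1 ^ 2) * (lam2 ^ 2 / δ ^ 2) + 2 * (lam2 ^ 2 / δ) + 20 * lam2 ^ 2 := by
      ring
    rw [this]; linarith
  have := div_le_div_of_nonneg_right tot hn0.le
  have e : (2 + lam1 + 2 * lam2 + 9 * lam1 ^ 2 + 20 * lam2 ^ 2) / n =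
    2 / n + lam1 / n + 2 * lam2 / n + 9 * lam1 ^ 2 / n + 20 * lam2 ^ 2 / n := by ring
  linarith

lemma exists_N (lam1 : ℝ) : ∃ N₀ : ℕ, 1 ≤ N₀ ∧ ∀ N : ℕ, N₀ ≤ N →
    64 ≤ Real.log N ∧ Real.log N ^ 2 ≤ N ∧ lam1 * Real.log N / N ≤ 1 / 2 := by
  have c : Tendsto (fun N : ℕ => (N : ℝ)) atTop atTop := tendsto_natCast_atTop_atTop
  have A := (Real.tendsto_log_atTop.comp c).eventually_ge_atTop 64
  have B : ∀ᶠ N : ℕ in atTop, Real.log N ^ 2 / N ≤ 1 := by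
    have := (Real.tendsto_pow_log_div_mul_add_atTop 1 0 2 one_ne_zero).comp c
    filter_upwards [this.eventually_le_const (zero_lt_one)] with N hN
    simpa using hN
  have D : ∀ᶠ N : ℕ in atTop, lam1 * (Real.log N / N) ≤ 1 / 2 := by
    have := ((Real.tendsto_pow_log_div_mul_add_atTop 1 0 1 one_ne_zero).comp c).const_mul lam1
    rw [mul_zero] at this
    filter_upwards [this.eventually_le_const (by norm_num : (0:ℝ) < 1 / 2)] with N hN
    simpa using hN
  obtain ⟨N₀, h⟩ := eventually_atTop.1 (A.and (B.and D))
  refine ⟨max N₀ 1, le_max_right _ _, fun N hN => ?_⟩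
  obtain ⟨h1, h2, h3⟩ := h N ((le_max_left _ _).trans hN)
  have hN0 : (0:ℝ) < N := by exact_mod_cast (le_max_right _ _).trans hN
  refine ⟨h1, ?_, ?_⟩
  · rwa [div_le_one hN0] at h2
  · rwa [mul_div_assoc]

/-- Lemma 2 (Hu 2022): for fixed `λ₁ ≥ 0` and `δ > 0`,
`sup_{δ ≤ λ₂ ≤ √N} P(ℓ(𝐪) ≤ −Cλ₂²) → 0` as `C → ∞` and `N → ∞`, where
`q¹,…,q^N` are i.i.d. Uniform(0,1). -/
theorem sl_score_lower_tail_uniform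
    (lam1 δ : ℝ) (hlam1 : 0 ≤ lam1) (hδ : 0 < δ) :
    ∀ η > 0, ∃ C₀ : ℝ, ∃ N₀ : ℕ, 1 ≤ N₀ ∧ ∀ C ≥ C₀, ∀ N ≥ N₀,
      ∀ lam2 : ℝ, δ ≤ lam2 → lam2 ≤ Real.sqrt N →
        uniformCube N {q | ∑ n : Fin N, slTerm N lam1 lam2 (q n) ≤ -C * lam2 ^ 2} ≤
          ENNReal.ofReal η := by
  intro η hη
  obtain ⟨N₀, hN₀, hN⟩ := exists_N lam1
  set K : ℝ := (2 + lam1 + 9 * lam1 ^ 2) / δ ^ 2 + 2 / δ + 20 with hK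
  refine ⟨K + 1 / (η * δ ^ 2), N₀, hN₀, fun C hC N hNN lam2 h1 h2 => ?_⟩
  obtain ⟨hL, hLn, ha⟩ := hN N hNN
  have hNpos : 0 < N := by omega
  have hn1 : (1:ℝ) ≤ N := by exact_mod_cast hNpos
  have hn0 : (0:ℝ) < N := by linarith
  have hl0 : 0 < lam2 := by linarith
  have hL0 : 0 < Real.log N := by linarith
  have ha0 : 0 ≤ lam1 * Real.log N / N := by positivity
  have hb0 : 0 ≤ lam2 / Real.sqrt (N * Real.log N) := by positivity
  have hb : lam2 / Real.sqrt (N * Real.log N) ≤ 1 / 8 := by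
    have hs : 8 ≤ Real.sqrt (Real.log N) := Real.le_sqrt_of_sq_le (by linarith)
    rw [Real.sqrt_mul hn0.le, div_le_div_iff₀ (by positivity) (by norm_num)]
    nlinarith [Real.sqrt_pos.2 hn0]
  have hab : lam1 * Real.log N / N / 2 + 2 * (lam2 / Real.sqrt (N * Real.log N)) ≤ 1 / 2 := by
    linarith
  have hInt := phi_integral ha0 hb0 hab hn1
  have hnum := numeric_bound hlam1 hδ h1 hn1 (by linarith : 1 ≤ Real.log N) hLn
  have := markov_bound (c := C * lam2 ^ 2) (r := K * lam2 ^ 2) hNpos rfl rfl ha0 hb0 hab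
    (by rw [hK]; linarith)
  rw [neg_mul]
  refine this.trans (ENNReal.ofReal_le_ofReal ?_)
  have hsq : δ ^ 2 ≤ lam2 ^ 2 := pow_le_pow_left₀ hδ.le h1 2
  have hCK : 1 / (η * δ ^ 2) ≤ C - K := by linarith
  have hη2 : 1 / η ≤ (C - K) * lam2 ^ 2 := by
    calc 1 / η = 1 / (η * δ ^ 2) * δ ^ 2 := by field_simp
      _ ≤ (C - K) * lam2 ^ 2 := by
        apply mul_le_mul hCK hsq (by positivity)
        exact le_trans (by positivity) hCK
  calc Real.exp (K * lam2 ^ 2 - C * lam2 ^ 2) ≤ Real.exp (-(1 / η)) := by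
        apply Real.exp_le_exp.2; linarith
    _ = (Real.exp (1 / η))⁻¹ := Real.exp_neg _
    _ ≤ (1 / η)⁻¹ := by
        apply inv_anti₀ (by positivity)
        linarith [Real.add_one_le_exp (1 / η)]
    _ = η := by simp

end
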